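/- In the braid group B_n, the element θ_n = Δ_n² admits the presentation θ_n = (σ_{n-1}²σ_{n-2}⋯σ_1)^{n-1}. -/

import Mathlib

/-- The ascending product `σ_1 σ_2 ⋯ σ_k` of braid generators. -/
def ascProd {G : Type*} [Monoid G] (σ : ℕ → G) (k : ℕ) : G :=
  ((List.range k).map (fun t => σ (t + 1))).prod

/-- The Garside element `Δ_n = (σ_1⋯σ_{n-1})(σ_1⋯σ_{n-2})⋯(σ_1σ_2)σ_1`. -/
def garside {G : Type*} [Monoid G] (σ : ℕ → G) (n : ℕ) : G :=
  (((List.range (n - 1)).reverse).map (fun k => ascProd σ (k + 1))).prod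

/-- The descending product `σ_{n-1} σ_{n-2} ⋯ σ_1` of braid generators. -/
def descProd {G : Type*} [Monoid G] (σ : ℕ → G) (n : ℕ) : G :=
  ((List.range (n - 1)).map (fun t => σ (n - 1 - t))).prod

section helpers
variable {G : Type*} [Group G]

/-- Recursive descending product. -/
def dP (σ : ℕ → G) : ℕ → G
  | 0 => 1
  | k + 1 => σ (k + 1) * dP σ k

/-- Recursive ascending product. -/
def aP (σ : ℕ → G) : ℕ → G
  | 0 => 1
  | k + 1 => aP σ k * σ (k + 1)

/-- Recursive Garside element. -/
def gP (σ : ℕ → G) : ℕ → G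
  | 0 => 1
  | k + 1 => aP σ (k + 1) * gP σ k

theorem ascProd_eq (σ : ℕ → G) (k : ℕ) : ascProd σ k = aP σ k := by
  induction k with
  | zero => rfl
  | succ k ih =>
    rw [aP, ← ih]
    simp [ascProd, List.range_succ]

theorem descProd_eq (σ : ℕ → G) (k : ℕ) : descProd σ (k + 1) = dP σ k := by
  induction k with
  | zero => rfl
  | succ k ih =>
    rw [dP, ← ih]
    simp only [descProd, Nat.add_sub_cancel, List.range_succ_eq_map, List.map_cons, List.prod_cons,
      List.map_map, Nat.sub_zero]
    congr 3
    funext t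
    simp only [Function.comp]
    congr 1
    omega

theorem garside_eq (σ : ℕ → G) (k : ℕ) : garside σ (k + 1) = gP σ k := by
  induction k with
  | zero => rfl
  | succ k ih =>
    rw [gP, ← ih, ← ascProd_eq]
    simp [garside, List.range_succ]

theorem dP_comm (σ : ℕ → G) (m : ℕ)
    (hcomm : ∀ i j, 1 ≤ i → i + 2 ≤ j → j ≤ m → σ i * σ j = σ j * σ i)
    (k j : ℕ) (h : k + 2 ≤ j) (hj : j ≤ m) : Commute (σ j) (dP σ k) := by
  induction k with
  | zero => exact Commute.one_right _
  | succ k ih =>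
    exact Commute.mul_right (hcomm (k + 1) j (by omega) (by omega) hj).symm (ih (by omega))

theorem aP_comm (σ : ℕ → G) (m : ℕ)
    (hcomm : ∀ i j, 1 ≤ i → i + 2 ≤ j → j ≤ m → σ i * σ j = σ j * σ i)
    (k j : ℕ) (h : k + 2 ≤ j) (hj : j ≤ m) : Commute (σ j) (aP σ k) := by
  induction k with
  | zero => exact Commute.one_right _
  | succ k ih =>
    exact Commute.mul_right (ih (by omega)) (hcomm (k + 1) j (by omega) (by omega) hj).symm

theorem gP_comm (σ : ℕ → G) (m : ℕ)
    (hcomm : ∀ i j, 1 ≤ i → i + 2 ≤ j → j ≤ m → σ i * σ j = σ j * σ i)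
    (k j : ℕ) (h : k + 2 ≤ j) (hj : j ≤ m) : Commute (σ j) (gP σ k) := by
  induction k with
  | zero => exact Commute.one_right _
  | succ k ih =>
    exact Commute.mul_right (aP_comm σ m hcomm (k + 1) j h hj) (ih (by omega))

theorem gP_succ' (σ : ℕ → G) (m : ℕ)
    (hcomm : ∀ i j, 1 ≤ i → i + 2 ≤ j → j ≤ m → σ i * σ j = σ j * σ i)
    (k : ℕ) (hk : k + 1 ≤ m) : gP σ (k + 1) = gP σ k * dP σ (k + 1) := by
  induction k with
  | zero => simp [gP, aP, dP]
  | succ k ih =>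
    have hc := (gP_comm σ m hcomm k (k + 2) le_rfl hk).eq
    calc gP σ (k + 2) = aP σ (k + 1) * σ (k + 2) * gP σ (k + 1) := rfl
      _ = aP σ (k + 1) * (σ (k + 2) * gP σ k) * dP σ (k + 1) := by
        rw [ih (by omega)]; simp only [mul_assoc]
      _ = (aP σ (k + 1) * gP σ k) * (σ (k + 2) * dP σ (k + 1)) := by
        rw [hc]; simp only [mul_assoc]
      _ = _ := rfl

theorem dP_shift (σ : ℕ → G) (m : ℕ)
    (hcomm : ∀ i j, 1 ≤ i → i + 2 ≤ j → j ≤ m → σ i * σ j = σ j * σ i)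
    (hbraid : ∀ i, 1 ≤ i → i + 1 ≤ m →
      σ i * σ (i + 1) * σ i = σ (i + 1) * σ i * σ (i + 1))
    (k i : ℕ) (hk : k ≤ m) (hi : 1 ≤ i) (hik : i + 1 ≤ k) :
    dP σ k * σ (i + 1) = σ i * dP σ k := by
  induction k with
  | zero => omega
  | succ k ih =>
    rcases Nat.lt_or_ge i k with h | h
    · rw [dP, mul_assoc, ih (by omega) (by omega), ← mul_assoc, ← mul_assoc,
        hcomm i (k + 1) hi (by omega) hk]
    · obtain rfl : i = k := by omega
      obtain ⟨j, rfl⟩ : ∃ j, i = j + 1 := ⟨i - 1, by omega⟩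
      have hc := (dP_comm σ m hcomm j (j + 2) le_rfl hk).eq
      have hb := hbraid (j + 1) hi hk
      calc σ (j + 2) * (σ (j + 1) * dP σ j) * σ (j + 2)
          = σ (j + 2) * σ (j + 1) * (dP σ j * σ (j + 2)) := by simp only [mul_assoc]
        _ = σ (j + 2) * σ (j + 1) * σ (j + 2) * dP σ j := by rw [← hc]; simp only [mul_assoc]
        _ = σ (j + 1) * σ (j + 2) * σ (j + 1) * dP σ j := by rw [← hb]
        _ = σ (j + 1) * (σ (j + 2) * (σ (j + 1) * dP σ j)) := by simp only [mul_assoc]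

theorem aP_shift (σ : ℕ → G) (m : ℕ)
    (hcomm : ∀ i j, 1 ≤ i → i + 2 ≤ j → j ≤ m → σ i * σ j = σ j * σ i)
    (hbraid : ∀ i, 1 ≤ i → i + 1 ≤ m →
      σ i * σ (i + 1) * σ i = σ (i + 1) * σ i * σ (i + 1))
    (k i : ℕ) (hk : k ≤ m) (hi : 1 ≤ i) (hik : i + 1 ≤ k) :
    aP σ k * σ i = σ (i + 1) * aP σ k := by
  induction k with
  | zero => omega
  | succ k ih =>
    rcases Nat.lt_or_ge i k with h | h
    · rw [aP, mul_assoc, ← hcomm i (k + 1) hi (by omega) hk, ← mul_assoc,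
        ih (by omega) (by omega), mul_assoc]
    · obtain rfl : i = k := by omega
      obtain ⟨j, rfl⟩ : ∃ j, i = j + 1 := ⟨i - 1, by omega⟩
      have hc := (aP_comm σ m hcomm j (j + 2) le_rfl hk).eq
      have hb := hbraid (j + 1) hi hk
      calc aP σ j * σ (j + 1) * σ (j + 2) * σ (j + 1)
          = aP σ j * (σ (j + 1) * σ (j + 2) * σ (j + 1)) := by simp only [mul_assoc]
        _ = (aP σ j * σ (j + 2)) * σ (j + 1) * σ (j + 2) := by rw [hb]; simp only [mul_assoc]
        _ = σ (j + 2) * (aP σ j * σ (j + 1) * σ (j + 2)) := by rw [← hc]; simp only [mul_assoc]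

theorem gP_comm_da (σ : ℕ → G) (m : ℕ)
    (hcomm : ∀ i j, 1 ≤ i → i + 2 ≤ j → j ≤ m → σ i * σ j = σ j * σ i)
    (hbraid : ∀ i, 1 ≤ i → i + 1 ≤ m →
      σ i * σ (i + 1) * σ i = σ (i + 1) * σ i * σ (i + 1))
    (l k : ℕ) (hl : l ≤ m) (hk : k + 1 ≤ l) :
    Commute (dP σ l * aP σ l) (gP σ k) := by
  have hs : ∀ i, 1 ≤ i → i + 1 ≤ l → Commute (dP σ l * aP σ l) (σ i) := by
    intro i h1 h2
    change _ * _ = _ * _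
    rw [mul_assoc, aP_shift σ m hcomm hbraid l i hl h1 h2, ← mul_assoc,
      dP_shift σ m hcomm hbraid l i hl h1 h2, mul_assoc]
  have ha : ∀ k, k + 1 ≤ l → Commute (dP σ l * aP σ l) (aP σ k) := by
    intro k
    induction k with
    | zero => intro _; exact Commute.one_right _
    | succ k ih => intro h; exact Commute.mul_right (ih (by omega)) (hs _ (by omega) h)
  induction k with
  | zero => exact Commute.one_right _
  | succ k ih => exact Commute.mul_right (ha _ hk) (ih (by omega))

theorem dP_pow_shift (σ : ℕ → G) (m : ℕ)
    (hcomm : ∀ i j, 1 ≤ i → i + 2 ≤ j → j ≤ m → σ i * σ j = σ j * σ i)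
    (hbraid : ∀ i, 1 ≤ i → i + 1 ≤ m →
      σ i * σ (i + 1) * σ i = σ (i + 1) * σ i * σ (i + 1))
    (l k j : ℕ) (hl : l ≤ m) (h : k + j + 1 ≤ l) :
    dP σ l ^ k * σ (k + j + 1) = σ (j + 1) * dP σ l ^ k := by
  induction k with
  | zero => simp
  | succ k ih =>
    have := dP_shift σ m hcomm hbraid l (k + j + 1) hl (by omega) (by omega)
    rw [show k + 1 + j + 1 = k + j + 1 + 1 by ring, pow_succ, mul_assoc, this, ← mul_assoc,
      ih (by omega), mul_assoc]

theorem pow_one' (σ : ℕ → G) (m : ℕ)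
    (hcomm : ∀ i j, 1 ≤ i → i + 2 ≤ j → j ≤ m → σ i * σ j = σ j * σ i)
    (hbraid : ∀ i, 1 ≤ i → i + 1 ≤ m →
      σ i * σ (i + 1) * σ i = σ (i + 1) * σ i * σ (i + 1))
    (l k j : ℕ) (hl : l ≤ m) (h : k + j = l) :
    (σ l * dP σ l) ^ k = dP σ l * (dP σ j)⁻¹ * dP σ l ^ k := by
  induction k generalizing j with
  | zero => obtain rfl : j = l := by omega
            simp
  | succ k ih =>
    have hp := dP_pow_shift σ m hcomm hbraid l k j hl (by omega)
    rw [show k + j + 1 = l by omega] at hp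
    rw [pow_succ, ih (j + 1) (by omega), pow_succ (dP σ l) k]
    calc dP σ l * (dP σ (j + 1))⁻¹ * dP σ l ^ k * (σ l * dP σ l)
        = dP σ l * (dP σ (j + 1))⁻¹ * (dP σ l ^ k * σ l) * dP σ l := by simp only [mul_assoc]
      _ = _ := by rw [hp, dP]; group

theorem pow_two' (σ : ℕ → G) (m : ℕ)
    (hcomm : ∀ i j, 1 ≤ i → i + 2 ≤ j → j ≤ m → σ i * σ j = σ j * σ i)
    (hbraid : ∀ i, 1 ≤ i → i + 1 ≤ m →
      σ i * σ (i + 1) * σ i = σ (i + 1) * σ i * σ (i + 1))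
    (l k j : ℕ) (hl : l ≤ m) (h : k + j = l) :
    ((σ l)⁻¹ * dP σ l) ^ k = (aP σ l)⁻¹ * aP σ j * dP σ l ^ k := by
  induction k generalizing j with
  | zero => obtain rfl : j = l := by omega
            simp
  | succ k ih =>
    have hp := dP_pow_shift σ m hcomm hbraid l k j hl (by omega)
    rw [show k + j + 1 = l by omega] at hp
    have hp' : dP σ l ^ k * (σ l)⁻¹ = (σ (j + 1))⁻¹ * dP σ l ^ k := by
      rw [mul_inv_eq_iff_eq_mul, mul_assoc, hp, inv_mul_cancel_left]
    rw [pow_succ, ih (j + 1) (by omega), pow_succ (dP σ l) k]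
    calc (aP σ l)⁻¹ * aP σ (j + 1) * dP σ l ^ k * ((σ l)⁻¹ * dP σ l)
        = (aP σ l)⁻¹ * aP σ (j + 1) * (dP σ l ^ k * (σ l)⁻¹) * dP σ l := by simp only [mul_assoc]
      _ = _ := by rw [hp', aP]; group

theorem gP_sq (σ : ℕ → G) (m : ℕ)
    (hcomm : ∀ i j, 1 ≤ i → i + 2 ≤ j → j ≤ m → σ i * σ j = σ j * σ i)
    (hbraid : ∀ i, 1 ≤ i → i + 1 ≤ m →
      σ i * σ (i + 1) * σ i = σ (i + 1) * σ i * σ (i + 1))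
    (l : ℕ) (hl : l ≤ m) : gP σ l ^ 2 = dP σ l ^ (l + 1) := by
  induction l with
  | zero => simp [gP, dP]
  | succ l ih =>
    have h2 := pow_two' σ m hcomm hbraid (l + 1) (l + 1) 0 hl rfl
    have hd : (σ (l + 1))⁻¹ * dP σ (l + 1) = dP σ l := by rw [dP, inv_mul_cancel_left]
    rw [hd, ← ih (by omega)] at h2
    have hc := (gP_comm_da σ m hcomm hbraid (l + 1) l hl le_rfl).eq
    calc gP σ (l + 1) ^ 2 = (gP σ l * dP σ (l + 1)) * (aP σ (l + 1) * gP σ l) := by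
          rw [pow_two]
          nth_rewrite 1 [gP_succ' σ m hcomm l hl]
          rfl
      _ = (gP σ l * (dP σ (l + 1) * aP σ (l + 1))) * gP σ l := by simp only [mul_assoc]
      _ = dP σ (l + 1) * aP σ (l + 1) * gP σ l ^ 2 := by
          rw [← hc, pow_two]; simp only [mul_assoc]
      _ = dP σ (l + 1) ^ (l + 1 + 1) := by
          rw [h2, pow_succ' _ (l + 1), aP.eq_1]
          group

end helpers

/-- In the braid group `B_n`, the element `θ_n = Δ_n²` admits the presentation
`θ_n = (σ_{n-1}²σ_{n-2}⋯σ_1)^{n-1}`.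
(Stated for any group with elements satisfying the braid relations, which is
equivalent by the universal property of `B_n`.) -/
theorem garside_sq_alt {G : Type*} [Group G] (n : ℕ) (σ : ℕ → G)
    (hcomm : ∀ i j, 1 ≤ i → i + 2 ≤ j → j ≤ n - 1 → σ i * σ j = σ j * σ i)
    (hbraid : ∀ i, 1 ≤ i → i + 1 ≤ n - 1 →
      σ i * σ (i + 1) * σ i = σ (i + 1) * σ i * σ (i + 1)) :
    garside σ n ^ 2 = (σ (n - 1) * descProd σ n) ^ (n - 1) := by
  rcases n with _ | m
  · simp [garside]
  · simp only [Nat.add_sub_cancel] at hcomm hbraid ⊢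
    rw [garside_eq, descProd_eq, gP_sq σ m hcomm hbraid m le_rfl,
      pow_one' σ m hcomm hbraid m m 0 le_rfl rfl, pow_succ', dP.eq_1]
    simp
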